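/- Let μ₁ ≥ μ_M > 0 be reals, let B ∈ [0,∞], let b = (b₁, b₂) ∈ ℝ², and let z = (z₁, z₂) : [0,∞) → ℝ² be cadlag. Define the operator T mapping a cadlag function w̃ = (w̃₁, w̃₂) : [0,∞) → ℝ² to the function T(w̃) with components T(w̃)₁(t) = b₁ + z₁(t) − ∫₀ᵗ (μ_M·φ₀(w̃₁)(s) − μ₁·φ_B(w̃₂ + ψ₀(w̃₁))(s)) ds and T(w̃)₂(t) = b₂ + z₂(t) − ∫₀ᵗ μ₁·φ_B(w̃₂ + ψ₀(w̃₁))(s) ds. Then for all cadlag w̃, ṽ : [0,∞) → ℝ² and all t ≥ 0, ‖T(w̃) − T(ṽ)‖_t ≤ 6μ₁·t·‖w̃ − ṽ‖_t. -/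

import Mathlib

open MeasureTheory

/-- A function on `[0,∞)` (encoded as a function on `ℝ`) is cadlag: right
continuous at every `t ≥ 0` and possessing left limits at every `t > 0`. -/
def CadlagOn {E : Type*} [TopologicalSpace E] (f : ℝ → E) : Prop :=
  (∀ t : ℝ, 0 ≤ t → ContinuousWithinAt f (Set.Ici t) t) ∧
  (∀ t : ℝ, 0 < t → ∃ l : E, Filter.Tendsto f (nhdsWithin t (Set.Iio t)) (nhds l))

/-- One-sided reflection map with (finite) upper barrier `κ`: regulator part. -/
noncomputable def psiRefl (κ : ℝ) (x : ℝ → ℝ) (t : ℝ) : ℝ :=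
  sSup ((fun u => max (x u - κ) 0) '' Set.Icc (0:ℝ) t)

/-- One-sided reflection map with (finite) upper barrier `κ`: reflected part. -/
noncomputable def phiRefl (κ : ℝ) (x : ℝ → ℝ) (t : ℝ) : ℝ :=
  x t - psiRefl κ x t

/-- Regulator part of the reflection map with barrier `B ∈ [0,∞]`; for `B = ∞`
one sets `ψ_∞(x) = 0`. -/
noncomputable def psiBar (B : ENNReal) (x : ℝ → ℝ) (t : ℝ) : ℝ :=
  if B = ⊤ then 0 else psiRefl B.toReal x t

/-- Reflected part of the reflection map with barrier `B ∈ [0,∞]`; for `B = ∞`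
one sets `φ_∞(x) = x`. -/
noncomputable def phiBar (B : ENNReal) (x : ℝ → ℝ) (t : ℝ) : ℝ :=
  x t - psiBar B x t

/-- Uniform norm on `[0,t]` for `ℝ²`-valued functions; on `ℝ²` the norm
is the maximum of absolute values of the coordinates. -/
noncomputable def unifNorm2 (t : ℝ) (f : ℝ → ℝ × ℝ) : ℝ :=
  sSup ((fun s => max |(f s).1| |(f s).2|) '' Set.Icc (0:ℝ) t)

/-- The operator `T` of the contraction argument in the proof of Lemma 4. -/
noncomputable def Tmap (μ₁ μM : ℝ) (B : ENNReal) (b₁ b₂ : ℝ) (z₁ z₂ : ℝ → ℝ)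
    (w : ℝ → ℝ × ℝ) : ℝ → ℝ × ℝ := fun t =>
  (b₁ + z₁ t - ∫ s in (0:ℝ)..t,
      (μM * phiRefl 0 (fun u => (w u).1) s -
        μ₁ * phiBar B (fun u => (w u).2 + psiRefl 0 (fun r => (w r).1) u) s),
   b₂ + z₂ t - ∫ s in (0:ℝ)..t,
      μ₁ * phiBar B (fun u => (w u).2 + psiRefl 0 (fun r => (w r).1) u) s)


/-- Bounded and a.e. measurable on `[0,t]`. -/
def GoodOn (t : ℝ) (x : ℝ → ℝ) : Prop :=
  (∃ C : ℝ, ∀ s ∈ Set.Icc (0:ℝ) t, |x s| ≤ C) ∧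
    AEMeasurable x (volume.restrict (Set.Icc (0:ℝ) t))

theorem cadlag_bdd {x : ℝ → ℝ} (hx : CadlagOn x) (t : ℝ) :
    ∃ C : ℝ, ∀ s ∈ Set.Icc (0:ℝ) t, |x s| ≤ C := by
  refine (isCompact_Icc : IsCompact (Set.Icc (0:ℝ) t)).induction_on
    (p := fun S => ∃ C : ℝ, ∀ s ∈ S, |x s| ≤ C) ⟨0, by simp⟩ ?_ ?_ ?_
  · rintro S T hST ⟨C, hC⟩
    exact ⟨C, fun s hs => hC s (hST hs)⟩
  · rintro S T ⟨C, hC⟩ ⟨D, hD⟩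
    refine ⟨max C D, ?_⟩
    rintro s (hs | hs)
    · exact (hC s hs).trans (le_max_left _ _)
    · exact (hD s hs).trans (le_max_right _ _)
  · intro a ha
    have h1 : ∀ᶠ s in nhdsWithin a (Set.Ici a), |x s| < |x a| + 1 :=
      (hx.1 a ha.1).abs.eventually (gt_mem_nhds (by linarith))
    have h2 : ∃ D : ℝ, ∀ᶠ s in nhdsWithin a (Set.Iio a), 0 ≤ s → |x s| < D := by
      rcases ha.1.eq_or_lt with h | h
      · refine ⟨0, ?_⟩
        filter_upwards [self_mem_nhdsWithin] with s hs h0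
        rw [← h] at hs
        exact absurd h0 (not_le.2 hs)
      · obtain ⟨l, hl⟩ := hx.2 a h
        refine ⟨|l| + 1, ?_⟩
        have := hl.abs.eventually (gt_mem_nhds (show |l| < |l| + 1 by linarith))
        filter_upwards [this] with s hs _ using hs
    obtain ⟨D, h2⟩ := h2
    rw [eventually_nhdsWithin_iff] at h1 h2
    refine ⟨{s | 0 ≤ s → |x s| ≤ max (|x a| + 1) D} ∩ Set.Icc 0 t, ?_, max (|x a| + 1) D, ?_⟩
    · refine Filter.inter_mem (mem_nhdsWithin_of_mem_nhds ?_) self_mem_nhdsWithin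
      filter_upwards [h1, h2] with s k1 k2 h0
      rcases lt_or_ge s a with h | h
      · exact (k2 h h0).le.trans (le_max_right _ _)
      · exact (k1 h).le.trans (le_max_left _ _)
    · rintro s ⟨h, h'⟩
      exact h h'.1

theorem cadlag_meas {x : ℝ → ℝ} (hx : CadlagOn x) (t : ℝ) :
    AEMeasurable x (volume.restrict (Set.Icc (0:ℝ) t)) := by
  refine aemeasurable_of_tendsto_metrizable_ae Filter.atTop
    (f := fun (n : ℕ) (s : ℝ) => x (((⌊((n:ℝ) + 1) * s⌋ : ℤ) + 1) / ((n:ℝ) + 1))) ?_ ?_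
  · intro n
    have h1 : Measurable (fun s : ℝ => ⌊((n:ℝ) + 1) * s⌋) :=
      Int.measurable_floor.comp (measurable_const.mul measurable_id)
    have h2 : Measurable (fun k : ℤ => x (((k:ℝ) + 1) / ((n:ℝ) + 1))) := measurable_from_top
    exact (h2.comp h1).aemeasurable
  · filter_upwards [ae_restrict_mem measurableSet_Icc] with s hs
    refine (hx.1 s hs.1).tendsto.comp (tendsto_nhdsWithin_iff.2 ⟨?_, ?_⟩)
    · refine tendsto_of_tendsto_of_tendsto_of_le_of_le (tendsto_const_nhds (x := s))
        (h := fun n : ℕ => s + 1 / ((n:ℝ) + 1)) ?_ ?_ ?_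
      · simpa using tendsto_const_nhds.add (tendsto_one_div_add_atTop_nhds_zero_nat (𝕜 := ℝ))
      · intro n
        have hn : (0:ℝ) < (n:ℝ) + 1 := by positivity
        show s ≤ _
        rw [le_div_iff₀ hn]
        linarith [Int.lt_floor_add_one (((n:ℝ) + 1) * s)]
      · intro n
        have hn : (0:ℝ) < (n:ℝ) + 1 := by positivity
        show _ / _ ≤ s + 1 / ((n:ℝ) + 1)
        rw [div_le_iff₀ hn, add_mul s, one_div, inv_mul_cancel₀ hn.ne']
        linarith [Int.floor_le (((n:ℝ) + 1) * s)]
    · refine Filter.Eventually.of_forall fun n => ?_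
      have hn : (0:ℝ) < (n:ℝ) + 1 := by positivity
      show s ≤ _
      rw [le_div_iff₀ hn]
      linarith [Int.lt_floor_add_one (((n:ℝ) + 1) * s)]

theorem cadlag_good {x : ℝ → ℝ} (hx : CadlagOn x) (t : ℝ) : GoodOn t x :=
  ⟨cadlag_bdd hx t, cadlag_meas hx t⟩

theorem cadlag_comp {w : ℝ → ℝ × ℝ} (hw : CadlagOn w) {g : ℝ × ℝ → ℝ} (hg : Continuous g) :
    CadlagOn (fun u => g (w u)) := by
  refine ⟨fun t ht => hg.continuousAt.comp_continuousWithinAt (hw.1 t ht), fun t ht => ?_⟩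
  obtain ⟨l, hl⟩ := hw.2 t ht
  exact ⟨g l, (hg.tendsto l).comp hl⟩

theorem GoodOn.add {t : ℝ} {x y : ℝ → ℝ} (hx : GoodOn t x) (hy : GoodOn t y) :
    GoodOn t (fun s => x s + y s) := by
  obtain ⟨⟨C, hC⟩, h1⟩ := hx
  obtain ⟨⟨D, hD⟩, h2⟩ := hy
  exact ⟨⟨C + D, fun s hs => (abs_add_le _ _).trans (add_le_add (hC s hs) (hD s hs))⟩, h1.add h2⟩

theorem GoodOn.mul_left {t : ℝ} {x : ℝ → ℝ} (c : ℝ) (hx : GoodOn t x) :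
    GoodOn t (fun s => c * x s) := by
  obtain ⟨⟨C, hC⟩, h1⟩ := hx
  refine ⟨⟨|c| * C, fun s hs => ?_⟩, h1.const_mul c⟩
  rw [abs_mul]
  exact mul_le_mul_of_nonneg_left (hC s hs) (abs_nonneg c)

theorem GoodOn.sub {t : ℝ} {x y : ℝ → ℝ} (hx : GoodOn t x) (hy : GoodOn t y) :
    GoodOn t (fun s => x s - y s) := by
  have := hx.add (hy.mul_left (-1))
  convert this using 2
  ring

theorem psi_bddAbove {t : ℝ} {x : ℝ → ℝ} (κ : ℝ) (hx : GoodOn t x) {s : ℝ} (hs : s ≤ t) :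
    BddAbove ((fun u => max (x u - κ) 0) '' Set.Icc (0:ℝ) s) := by
  obtain ⟨⟨C, hC⟩, -⟩ := hx
  refine ⟨max (C - κ) 0, ?_⟩
  rintro _ ⟨u, hu, rfl⟩
  have := (le_abs_self _).trans (hC u ⟨hu.1, hu.2.trans hs⟩)
  exact max_le_max (by linarith) le_rfl

theorem psi_mono {t : ℝ} {x : ℝ → ℝ} (κ : ℝ) (hx : GoodOn t x) :
    MonotoneOn (psiRefl κ x) (Set.Icc 0 t) := by
  intro a ha b hb hab
  exact csSup_le_csSup (psi_bddAbove κ hx hb.2) ((Set.nonempty_Icc.2 ha.1).image _)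
    (Set.image_mono (Set.Icc_subset_Icc_right hab))

theorem psi_nonneg (κ : ℝ) (x : ℝ → ℝ) (s : ℝ) : 0 ≤ psiRefl κ x s := by
  apply Real.sSup_nonneg
  rintro _ ⟨u, -, rfl⟩
  exact le_max_right _ _

theorem GoodOn.psi {t : ℝ} {x : ℝ → ℝ} (κ : ℝ) (hx : GoodOn t x) : GoodOn t (psiRefl κ x) := by
  refine ⟨⟨psiRefl κ x t, fun s hs => ?_⟩,
    aemeasurable_restrict_of_monotoneOn measurableSet_Icc (psi_mono κ hx)⟩
  rw [abs_of_nonneg (psi_nonneg κ x s)]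
  exact psi_mono κ hx hs ⟨hs.1.trans hs.2, le_rfl⟩ hs.2

theorem GoodOn.phiBar {t : ℝ} {x : ℝ → ℝ} (B : ENNReal) (hx : GoodOn t x) :
    GoodOn t (phiBar B x) := by
  by_cases hB : B = ⊤
  · have : _root_.phiBar B x = x := by
      funext s; simp [_root_.phiBar, psiBar, hB]
    rwa [this]
  · have : _root_.phiBar B x = fun s => x s - psiRefl B.toReal x s := by
      funext s; simp [_root_.phiBar, psiBar, hB]
    rw [this]
    exact hx.sub (hx.psi _)

theorem psi_le {t D : ℝ} {x y : ℝ → ℝ} (κ : ℝ) (hy : GoodOn t y)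
    (h : ∀ s ∈ Set.Icc (0:ℝ) t, |x s - y s| ≤ D) {s : ℝ} (hs : s ∈ Set.Icc (0:ℝ) t) :
    psiRefl κ x s ≤ psiRefl κ y s + D := by
  refine csSup_le ((Set.nonempty_Icc.2 hs.1).image _) ?_
  rintro _ ⟨u, hu, rfl⟩
  have h1 : max (y u - κ) 0 ≤ psiRefl κ y s := le_csSup (psi_bddAbove κ hy hs.2) ⟨u, hu, rfl⟩
  have h2 := h u ⟨hu.1, hu.2.trans hs.2⟩
  have h3 := abs_le.1 h2
  have h4 := (abs_nonneg _).trans h2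
  have h5 := le_max_left (y u - κ) 0
  have h6 := le_max_right (y u - κ) 0
  exact max_le (by linarith) (by linarith)

theorem psi_lip {t D : ℝ} {x y : ℝ → ℝ} (κ : ℝ) (hx : GoodOn t x) (hy : GoodOn t y)
    (h : ∀ s ∈ Set.Icc (0:ℝ) t, |x s - y s| ≤ D) {s : ℝ} (hs : s ∈ Set.Icc (0:ℝ) t) :
    |psiRefl κ x s - psiRefl κ y s| ≤ D := by
  have h1 := psi_le κ hy h hs
  have h2 := psi_le κ hx (fun s hs => by rw [abs_sub_comm]; exact h s hs) hs
  exact abs_le.2 ⟨by linarith, by linarith⟩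

theorem phiBar_lip {t D : ℝ} {x y : ℝ → ℝ} (B : ENNReal) (hx : GoodOn t x) (hy : GoodOn t y)
    (h : ∀ s ∈ Set.Icc (0:ℝ) t, |x s - y s| ≤ D) {s : ℝ} (hs : s ∈ Set.Icc (0:ℝ) t) :
    |phiBar B x s - phiBar B y s| ≤ 2 * D := by
  have h1 := h s hs
  have h0 := (abs_nonneg _).trans h1
  by_cases hB : B = ⊤
  · simp only [phiBar, psiBar, hB, if_true, sub_zero]
    linarith
  · simp only [phiBar, psiBar, hB, if_false]
    have h2 := abs_le.1 (psi_lip B.toReal hx hy h hs)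
    have h1 := abs_le.1 h1
    exact abs_le.2 ⟨by linarith, by linarith⟩

theorem GoodOn.ii {t : ℝ} {x : ℝ → ℝ} (hx : GoodOn t x) {s : ℝ} (hs : s ∈ Set.Icc (0:ℝ) t) :
    IntervalIntegrable x volume 0 s := by
  obtain ⟨⟨C, hC⟩, hm⟩ := hx
  rw [intervalIntegrable_iff_integrableOn_Ioc_of_le hs.1]
  have : IntegrableOn x (Set.Icc 0 t) := by
    refine IntegrableOn.of_bound (by simp) hm.aestronglyMeasurable C ?_
    filter_upwards [ae_restrict_mem measurableSet_Icc] with u hu using hC u hu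
  exact this.mono_set (Set.Ioc_subset_Icc_self.trans (Set.Icc_subset_Icc_right hs.2))

theorem int_diff {t K : ℝ} {x y : ℝ → ℝ} (hx : GoodOn t x) (hy : GoodOn t y)
    (h : ∀ s ∈ Set.Icc (0:ℝ) t, |x s - y s| ≤ K) {s : ℝ} (hs : s ∈ Set.Icc (0:ℝ) t) (c : ℝ) :
    |(c - ∫ u in (0:ℝ)..s, x u) - (c - ∫ u in (0:ℝ)..s, y u)| ≤ K * t := by
  have hK := (abs_nonneg _).trans (h s hs)
  have e : (c - ∫ u in (0:ℝ)..s, x u) - (c - ∫ u in (0:ℝ)..s, y u)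
      = -∫ u in (0:ℝ)..s, (x u - y u) := by
    rw [intervalIntegral.integral_sub (hx.ii hs) (hy.ii hs)]; ring
  rw [e, abs_neg]
  have := intervalIntegral.norm_integral_le_of_norm_le_const (a := (0:ℝ)) (b := s) (C := K)
    (f := fun u => x u - y u) (fun u hu => by
      rw [Set.uIoc_of_le hs.1] at hu
      exact h u ⟨hu.1.le, hu.2.trans hs.2⟩)
  rw [Real.norm_eq_abs, sub_zero, abs_of_nonneg hs.1] at this
  exact this.trans (mul_le_mul_of_nonneg_left hs.2 hK)

/-- The operator `T` is `6μ₁t`-Lipschitz in the uniform norm on `[0,t]`. -/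
theorem Tmap_contraction
    (μ₁ μM : ℝ) (hμ : μM ≤ μ₁) (hμM : 0 < μM)
    (B : ENNReal) (b₁ b₂ : ℝ) (z₁ z₂ : ℝ → ℝ)
    (hz : CadlagOn (fun t => (z₁ t, z₂ t)))
    (w v : ℝ → ℝ × ℝ) (hw : CadlagOn w) (hv : CadlagOn v)
    (t : ℝ) (ht : 0 ≤ t) :
    unifNorm2 t (fun s => Tmap μ₁ μM B b₁ b₂ z₁ z₂ w s - Tmap μ₁ μM B b₁ b₂ z₁ z₂ v s)
      ≤ 6 * μ₁ * t * unifNorm2 t (fun s => w s - v s) := by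
  have w1 := cadlag_good (cadlag_comp hw continuous_fst) t
  have w2 := cadlag_good (cadlag_comp hw continuous_snd) t
  have v1 := cadlag_good (cadlag_comp hv continuous_fst) t
  have v2 := cadlag_good (cadlag_comp hv continuous_snd) t
  set D := unifNorm2 t (fun s => w s - v s) with hD
  have hDs : ∀ s ∈ Set.Icc (0:ℝ) t, max |(w s).1 - (v s).1| |(w s).2 - (v s).2| ≤ D := by
    intro s hs
    refine le_csSup ?_ ⟨s, hs, rfl⟩
    obtain ⟨⟨C1, h1⟩, -⟩ := w1.sub v1
    obtain ⟨⟨C2, h2⟩, -⟩ := w2.sub v2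
    refine ⟨max C1 C2, ?_⟩
    rintro _ ⟨u, hu, rfl⟩
    exact max_le_max (h1 u hu) (h2 u hu)
  have d1 : ∀ s ∈ Set.Icc (0:ℝ) t, |(w s).1 - (v s).1| ≤ D :=
    fun s hs => (le_max_left _ _).trans (hDs s hs)
  have d2 : ∀ s ∈ Set.Icc (0:ℝ) t, |(w s).2 - (v s).2| ≤ D :=
    fun s hs => (le_max_right _ _).trans (hDs s hs)
  have hD0 : 0 ≤ D := (abs_nonneg _).trans (d1 0 ⟨le_rfl, ht⟩)
  have yw := w2.add (w1.psi 0)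
  have yv := v2.add (v1.psi 0)
  have d3 : ∀ s ∈ Set.Icc (0:ℝ) t,
      |((w s).2 + psiRefl 0 (fun r => (w r).1) s) - ((v s).2 + psiRefl 0 (fun r => (v r).1) s)|
        ≤ 2 * D := by
    intro s hs
    have a := abs_le.1 (d2 s hs)
    have b := abs_le.1 (psi_lip 0 w1 v1 d1 hs)
    exact abs_le.2 ⟨by linarith, by linarith⟩
  have hμ1 : 0 < μ₁ := hμM.trans_le hμ
  have gw := (yw.phiBar B).mul_left μ₁
  have gv := (yv.phiBar B).mul_left μ₁
  have dB : ∀ s ∈ Set.Icc (0:ℝ) t,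
      |μ₁ * phiBar B (fun u => (w u).2 + psiRefl 0 (fun r => (w r).1) u) s
        - μ₁ * phiBar B (fun u => (v u).2 + psiRefl 0 (fun r => (v r).1) u) s|
        ≤ 4 * μ₁ * D := by
    intro s hs
    rw [← mul_sub, abs_mul, abs_of_pos hμ1]
    have := mul_le_mul_of_nonneg_left (phiBar_lip B yw yv d3 hs) hμ1.le
    linarith
  have pw := (w1.sub (w1.psi 0)).mul_left μM
  have pv := (v1.sub (v1.psi 0)).mul_left μM
  have dM : ∀ s ∈ Set.Icc (0:ℝ) t,
      |μM * phiRefl 0 (fun u => (w u).1) s - μM * phiRefl 0 (fun u => (v u).1) s|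
        ≤ 2 * μ₁ * D := by
    intro s hs
    rw [← mul_sub, abs_mul, abs_of_pos hμM]
    have a := abs_le.1 (d1 s hs)
    have b := abs_le.1 (psi_lip 0 w1 v1 d1 hs)
    have c : |phiRefl 0 (fun u => (w u).1) s - phiRefl 0 (fun u => (v u).1) s| ≤ 2 * D := by
      unfold phiRefl
      exact abs_le.2 ⟨by linarith, by linarith⟩
    have := mul_le_mul hμ c (abs_nonneg _) hμ1.le
    linarith
  refine csSup_le ((Set.nonempty_Icc.2 ht).image _) ?_
  rintro _ ⟨s, hs, rfl⟩
  have hp : 0 ≤ μ₁ * D * t := by positivity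
  refine max_le ?_ ?_
  · have := int_diff (pw.sub gw) (pv.sub gv) (K := 6 * μ₁ * D) (fun s hs => by
      have a := abs_le.1 (dM s hs)
      have b := abs_le.1 (dB s hs)
      unfold phiRefl at a
      exact abs_le.2 ⟨by linarith, by linarith⟩) hs (b₁ + z₁ s)
    refine le_trans this (le_of_eq (by ring))
  · have := int_diff gw gv dB hs (b₂ + z₂ s)
    refine le_trans this (by nlinarith)
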